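/- Let α be a badly approximable real number with convergents (pₙ/qₙ)_{n ≥ 1}. Assume there exist a positive rational number x and a sequence of finite words (U_k)_{k ≥ 1} over the positive integers such that, for every k ≥ 1, the continued fraction expansion of α begins with the block U_k followed by the block U_k^x, and |U_{k+1}| > |U_k|. Set M = limsup_{ℓ → ∞} q_ℓ^{1/ℓ} and m = liminf_{ℓ → ∞} q_ℓ^{1/ℓ}. If x ≥ 1 or x > (1/2)·(log M)/(log m), then for every real number β equal to α up to a rational homography, i.e. β = (aα + b)/(cα + d) with integers a, b, c, d and ad − bc ≠ 0, one has inf_{q ≥ 1} q · ‖qα‖ · ‖qβ‖ = 0. -/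

import Mathlib

open Filter Topology

/-- Distance from a real number to the nearest integer. -/
noncomputable def nint (x : ℝ) : ℝ := |x - round x|

/-- A real number is badly approximable: `inf_{q ≥ 1} q·‖qα‖ > 0`. -/
def IsBad (α : ℝ) : Prop :=
  0 < ⨅ q : ℕ+, ((q : ℕ) : ℝ) * nint (((q : ℕ) : ℝ) * α)

/-- Denominators (continuants) of the continued fraction `[0; a 1, a 2, …]`:
`q 0 = 1`, `q 1 = a 1`, `q (j+2) = a (j+2) * q (j+1) + q j`. -/
def cfQ (a : ℕ → ℕ) : ℕ → ℕ
  | 0 => 1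
  | 1 => a 1
  | n + 2 => a (n + 2) * cfQ a (n + 1) + cfQ a n

/-- Numerators of the continued fraction `[0; a 1, a 2, …]`. -/
def cfP (a : ℕ → ℕ) : ℕ → ℕ
  | 0 => 0
  | 1 => 1
  | n + 2 => a (n + 2) * cfP a (n + 1) + cfP a n

/-- `a` (indexed from `1`) is the sequence of partial quotients of the continued
fraction expansion of `α`, i.e. `α = [0; a 1, a 2, …]`. -/
def IsCF (a : ℕ → ℕ) (α : ℝ) : Prop :=
  (∀ i, 1 ≤ i → 1 ≤ a i) ∧
    Tendsto (fun n => (cfP a n : ℝ) / (cfQ a n)) atTop (nhds α)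

/-- For a positive rational `x`, `wordPow W x` is the word `W^x = W^{⌊x⌋} W'`,
where `W'` is the prefix of `W` of length `⌈(x - ⌊x⌋)·|W|⌉`. -/
def wordPow (W : List ℕ) (x : ℚ) : List ℕ :=
  (List.replicate (⌊x⌋).toNat W).flatten ++
    W.take (⌈(x - (⌊x⌋ : ℚ)) * (W.length : ℚ)⌉).toNat

lemma nint_nonneg (x : ℝ) : 0 ≤ nint x := abs_nonneg _

lemma nint_le_abs_sub_int (x : ℝ) (z : ℤ) : nint x ≤ |x - z| := round_le x z

lemma cfQ_succ_succ (a : ℕ → ℕ) (n : ℕ) :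
    cfQ a (n + 2) = a (n + 2) * cfQ a (n + 1) + cfQ a n := rfl

lemma cfP_succ_succ (a : ℕ → ℕ) (n : ℕ) :
    cfP a (n + 2) = a (n + 2) * cfP a (n + 1) + cfP a n := rfl

lemma cfQ_pos {a : ℕ → ℕ} (ha : ∀ i, 1 ≤ i → 1 ≤ a i) (n : ℕ) : 0 < cfQ a n := by
  induction n using Nat.twoStepInduction with
  | zero => simp [cfQ]
  | one => exact ha 1 le_rfl
  | more n h _ => rw [cfQ_succ_succ]; omega

lemma cfP_le_cfQ {a : ℕ → ℕ} (ha : ∀ i, 1 ≤ i → 1 ≤ a i) (n : ℕ) : cfP a n ≤ cfQ a n := by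
  induction n using Nat.twoStepInduction with
  | zero => simp [cfQ, cfP]
  | one => simpa [cfQ, cfP] using ha 1 le_rfl
  | more n h h' =>
    rw [cfQ_succ_succ, cfP_succ_succ]
    gcongr

lemma cfQ_mono {a : ℕ → ℕ} (ha : ∀ i, 1 ≤ i → 1 ≤ a i) : Monotone (cfQ a) := by
  refine monotone_nat_of_le_succ fun n => ?_
  cases n with
  | zero => simpa [cfQ] using ha 1 le_rfl
  | succ n =>
    rw [cfQ_succ_succ]
    nlinarith [ha (n + 2) (by omega), cfQ_pos ha (n + 1)]

lemma mul_cfQ_le_cfQ_succ (a : ℕ → ℕ) (n : ℕ) :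
    a (n + 1) * cfQ a n ≤ cfQ a (n + 1) := by
  cases n with
  | zero => simp [cfQ]
  | succ n => exact Nat.le_add_right _ _

lemma cfQ_succ_le {a : ℕ → ℕ} (ha : ∀ i, 1 ≤ i → 1 ≤ a i) {K : ℕ} (hK : ∀ i, 1 ≤ i → a i ≤ K)
    (n : ℕ) : cfQ a (n + 1) ≤ (K + 1) * cfQ a n := by
  cases n with
  | zero => simpa [cfQ] using (hK 1 le_rfl).trans (Nat.le_succ K)
  | succ n =>
    rw [cfQ_succ_succ, add_mul, one_mul]
    exact add_le_add (Nat.mul_le_mul_right _ (hK _ (by omega))) (cfQ_mono ha (Nat.le_succ n))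

lemma cfQ_le_pow {a : ℕ → ℕ} (ha : ∀ i, 1 ≤ i → 1 ≤ a i) {K : ℕ} (hK : ∀ i, 1 ≤ i → a i ≤ K)
    (n : ℕ) : cfQ a n ≤ (K + 1) ^ n := by
  induction n with
  | zero => simp [cfQ]
  | succ n ih =>
    rw [pow_succ']
    exact (cfQ_succ_le ha hK n).trans (Nat.mul_le_mul_left _ ih)

lemma two_pow_le_cfQ_sq {a : ℕ → ℕ} (ha : ∀ i, 1 ≤ i → 1 ≤ a i) (n : ℕ) :
    2 ^ n ≤ 2 * cfQ a n ^ 2 := by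
  induction n using Nat.twoStepInduction with
  | zero => simp [cfQ]
  | one => simpa [cfQ] using Nat.one_le_pow 2 _ (ha 1 le_rfl)
  | more n h _ =>
    have h1 : 2 * cfQ a n ≤ cfQ a (n + 2) := by
      rw [cfQ_succ_succ]
      nlinarith [ha (n + 2) (by omega), cfQ_pos ha (n + 1), cfQ_mono ha (Nat.le_succ n)]
    have h2 := Nat.pow_le_pow_left h1 2
    rw [pow_add]
    nlinarith

lemma cf_det (a : ℕ → ℕ) (n : ℕ) :
    (cfP a (n + 1) : ℝ) * cfQ a n - cfP a n * cfQ a (n + 1) = (-1) ^ n := by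
  induction n with
  | zero => simp [cfP, cfQ]
  | succ n ih =>
    rw [cfP_succ_succ, cfQ_succ_succ, pow_succ, ← ih]
    push_cast
    ring

lemma cfQ_shift (a : ℕ → ℕ) (n j : ℕ) :
    cfQ a (n + 1 + j) = cfQ a (n + 1) * cfQ (fun i => a (i + (n + 1))) j
      + cfQ a n * cfP (fun i => a (i + (n + 1))) j := by
  induction j using Nat.twoStepInduction with
  | zero => simp [cfQ, cfP]
  | one =>
    rw [show n + 1 + 1 = n + 2 from rfl, cfQ_succ_succ]
    simp only [cfQ, cfP, show 1 + (n + 1) = n + 2 by omega]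
    ring
  | more j h h' =>
    rw [show n + 1 + (j + 2) = (n + 1 + j) + 2 by omega, cfQ_succ_succ, h,
      show n + 1 + j + 1 = n + 1 + (j + 1) by omega, h', cfQ_succ_succ, cfP_succ_succ,
      show j + 2 + (n + 1) = n + 1 + j + 2 by omega]
    ring

lemma cfP_shift (a : ℕ → ℕ) (n j : ℕ) :
    cfP a (n + 1 + j) = cfP a (n + 1) * cfQ (fun i => a (i + (n + 1))) j
      + cfP a n * cfP (fun i => a (i + (n + 1))) j := by
  induction j using Nat.twoStepInduction with
  | zero => simp [cfQ, cfP]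
  | one =>
    rw [show n + 1 + 1 = n + 2 from rfl, cfP_succ_succ]
    simp only [cfQ, cfP, show 1 + (n + 1) = n + 2 by omega]
    ring
  | more j h h' =>
    rw [show n + 1 + (j + 2) = (n + 1 + j) + 2 by omega, cfP_succ_succ, h,
      show n + 1 + j + 1 = n + 1 + (j + 1) by omega, h', cfQ_succ_succ, cfP_succ_succ,
      show j + 2 + (n + 1) = n + 1 + j + 2 by omega]
    ring

/-- The `n`-th convergent of the continued fraction with partial quotients `a`. -/
noncomputable def cfConv (a : ℕ → ℕ) (n : ℕ) : ℝ := (cfP a n : ℝ) / cfQ a n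

lemma cfConv_nonneg (a : ℕ → ℕ) (n : ℕ) : 0 ≤ cfConv a n := by
  unfold cfConv; positivity

lemma cfConv_le_one {a : ℕ → ℕ} (ha : ∀ i, 1 ≤ i → 1 ≤ a i) (n : ℕ) : cfConv a n ≤ 1 := by
  have := cfQ_pos ha n
  unfold cfConv
  rw [div_le_one (by positivity)]
  exact_mod_cast cfP_le_cfQ ha n

lemma one_le_shift {a : ℕ → ℕ} (ha : ∀ i, 1 ≤ i → 1 ≤ a i) (n : ℕ) :
    ∀ i, 1 ≤ i → 1 ≤ (fun i => a (i + n)) i := fun _ _ => ha _ (by omega)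

lemma cfConv_add {a : ℕ → ℕ} (ha : ∀ i, 1 ≤ i → 1 ≤ a i) (n j : ℕ) :
    cfConv a (n + 1 + j) =
      (cfP a (n + 1) + cfP a n * cfConv (fun i => a (i + (n + 1))) j) /
        (cfQ a (n + 1) + cfQ a n * cfConv (fun i => a (i + (n + 1))) j) := by
  have h0 := cfQ_pos (one_le_shift ha (n + 1)) j
  have h1 := cfQ_pos ha n
  have h2 := cfQ_pos ha (n + 1)
  unfold cfConv
  rw [cfQ_shift, cfP_shift]
  push_cast
  have h0' : (0 : ℝ) < cfQ (fun i => a (i + (n + 1))) j := by exact_mod_cast h0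
  have : (0 : ℝ) < cfQ a (n + 1) * cfQ (fun i => a (i + (n + 1))) j
      + cfQ a n * cfP (fun i => a (i + (n + 1))) j := by positivity
  have : (0 : ℝ) < cfQ a (n + 1)
      + cfQ a n * (cfP (fun i => a (i + (n + 1))) j / cfQ (fun i => a (i + (n + 1))) j) := by
    positivity
  field_simp

lemma cf_mobius_sub (a : ℕ → ℕ) (n : ℕ) {s t : ℝ}
    (hs : (cfQ a (n + 1) + cfQ a n * s : ℝ) ≠ 0) (ht : (cfQ a (n + 1) + cfQ a n * t : ℝ) ≠ 0) :
    (cfP a (n + 1) + cfP a n * s : ℝ) / (cfQ a (n + 1) + cfQ a n * s)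
      - (cfP a (n + 1) + cfP a n * t) / (cfQ a (n + 1) + cfQ a n * t)
    = (-1) ^ n * (t - s) /
      ((cfQ a (n + 1) + cfQ a n * s) * (cfQ a (n + 1) + cfQ a n * t)) := by
  rw [← cf_det a n, div_sub_div _ _ hs ht]
  congr 1
  ring

lemma cf_congr {a b : ℕ → ℕ} {N : ℕ} (h : ∀ i, 1 ≤ i → i ≤ N → a i = b i) (n : ℕ) (hn : n ≤ N) :
    cfQ a n = cfQ b n ∧ cfP a n = cfP b n := by
  induction n using Nat.twoStepInduction with
  | zero => simp [cfQ, cfP]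
  | one => simp [cfQ, cfP, h 1 le_rfl hn]
  | more n h0 h1 =>
    obtain ⟨h2, h3⟩ := h0 (by omega)
    obtain ⟨h4, h5⟩ := h1 (by omega)
    rw [cfQ_succ_succ, cfQ_succ_succ, cfP_succ_succ, cfP_succ_succ, h2, h3, h4, h5,
      h (n + 2) (by omega) hn]
    exact ⟨rfl, rfl⟩

lemma abs_cfConv_sub_le {a b : ℕ → ℕ} (ha : ∀ i, 1 ≤ i → 1 ≤ a i) (hb : ∀ i, 1 ≤ i → 1 ≤ b i)
    {l : ℕ} (h : ∀ i, 1 ≤ i → i ≤ l + 1 → a i = b i) (j : ℕ) :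
    |cfConv a (l + 1 + j) - cfConv b (l + 1 + j)| ≤ 1 / (cfQ a (l + 1) : ℝ) ^ 2 := by
  obtain ⟨e1, e2⟩ := cf_congr h (l + 1) le_rfl
  obtain ⟨e3, e4⟩ := cf_congr h l (by omega)
  rw [cfConv_add ha, cfConv_add hb, ← e1, ← e2, ← e3, ← e4]
  set s := cfConv (fun i => a (i + (l + 1))) j
  set t := cfConv (fun i => b (i + (l + 1))) j
  have hs0 : 0 ≤ s := cfConv_nonneg _ _
  have ht0 : 0 ≤ t := cfConv_nonneg _ _
  have hs1 : s ≤ 1 := cfConv_le_one (one_le_shift ha _) _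
  have ht1 : t ≤ 1 := cfConv_le_one (one_le_shift hb _) _
  have hq := cfQ_pos ha l
  have hq' := cfQ_pos ha (l + 1)
  rw [cf_mobius_sub a l (by positivity) (by positivity), abs_div, abs_mul, abs_pow, abs_neg,
    abs_one, one_pow, one_mul]
  have h1 : |t - s| ≤ 1 := abs_le.2 ⟨by linarith, by linarith⟩
  rw [abs_of_nonneg (a := (_ : ℝ) * _) (by positivity)]
  refine div_le_div₀ zero_le_one h1 (by positivity) ?_
  rw [sq]
  exact mul_le_mul (by nlinarith) (by nlinarith) (by positivity) (by positivity)

lemma abs_sub_convergent_le {a : ℕ → ℕ} {α : ℝ} (h : IsCF a α) (n : ℕ) :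
    |cfQ a n * α - cfP a n| ≤ 1 / cfQ a (n + 1) := by
  obtain ⟨ha, hlim⟩ := h
  have hq : 0 < cfQ a n := cfQ_pos ha n
  have hq' := cfQ_pos ha (n + 1)
  have hlim' : Tendsto (fun j => |cfQ a n * cfConv a (j + (n + 1)) - cfP a n|) atTop
      (𝓝 |cfQ a n * α - cfP a n|) :=
    ((((tendsto_add_atTop_iff_nat (n + 1)).2 hlim).const_mul _).sub_const _).abs
  refine le_of_tendsto hlim' (Eventually.of_forall fun j => ?_)
  show |cfQ a n * cfConv a (j + (n + 1)) - cfP a n| ≤ _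
  rw [add_comm j, cfConv_add ha]
  set s := cfConv (fun i => a (i + (n + 1))) j
  have hs0 : 0 ≤ s := cfConv_nonneg _ _
  have : (cfQ a n : ℝ) * ((cfP a (n + 1) + cfP a n * s) / (cfQ a (n + 1) + cfQ a n * s))
      - cfP a n = (-1) ^ n / (cfQ a (n + 1) + cfQ a n * s) := by
    rw [← cf_det a n]
    have : (0 : ℝ) < cfQ a (n + 1) + cfQ a n * s := by positivity
    field_simp
    ring
  rw [this, abs_div, abs_pow, abs_neg, abs_one, one_pow, abs_of_nonneg (by positivity)]
  refine one_div_le_one_div_of_le (by positivity) ?_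
  have : (0 : ℝ) ≤ cfQ a n * s := by positivity
  linarith

lemma IsBad.exists_bound {a : ℕ → ℕ} {α : ℝ} (hbad : IsBad α) (h : IsCF a α) :
    ∃ K : ℕ, ∀ i, 1 ≤ i → a i ≤ K := by
  set c := ⨅ q : ℕ+, ((q : ℕ) : ℝ) * nint (((q : ℕ) : ℝ) * α) with hc
  have hc0 : 0 < c := hbad
  refine ⟨⌊1 / c⌋₊, fun i hi => ?_⟩
  obtain ⟨n, rfl⟩ : ∃ n, i = n + 1 := ⟨i - 1, by omega⟩
  have hq : 0 < cfQ a n := cfQ_pos h.1 n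
  have hq' : 0 < cfQ a (n + 1) := cfQ_pos h.1 (n + 1)
  have h1 : c ≤ cfQ a n * nint (cfQ a n * α) := by
    refine ciInf_le (f := fun q : ℕ+ => ((q : ℕ) : ℝ) * nint (((q : ℕ) : ℝ) * α)) ⟨0, ?_⟩
      ⟨cfQ a n, hq⟩
    rintro _ ⟨q, rfl⟩
    exact mul_nonneg (by positivity) (nint_nonneg _)
  have h2 : nint (cfQ a n * α) ≤ 1 / cfQ a (n + 1) := by
    refine (nint_le_abs_sub_int _ (cfP a n)).trans ?_
    exact_mod_cast abs_sub_convergent_le h n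
  have h3 : (a (n + 1) : ℝ) * cfQ a n ≤ cfQ a (n + 1) := by
    exact_mod_cast mul_cfQ_le_cfQ_succ a n
  rw [Nat.le_floor_iff (by positivity), le_div_iff₀ hc0]
  have hq0 : (0 : ℝ) < cfQ a n := by exact_mod_cast hq
  have hq0' : (0 : ℝ) < cfQ a (n + 1) := by exact_mod_cast hq'
  calc (a (n + 1) : ℝ) * c ≤ a (n + 1) * (cfQ a n * (1 / cfQ a (n + 1))) := by
        refine mul_le_mul_of_nonneg_left (h1.trans ?_) (by positivity)
        exact mul_le_mul_of_nonneg_left h2 (by positivity)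
    _ = (a (n + 1) * cfQ a n) / cfQ a (n + 1) := by ring
    _ ≤ 1 := (div_le_one hq0').2 h3

/-- If the first `l + 1` partial quotients repeat after a period `n + 1`, then `α` is almost
a root of the quadratic polynomial of the purely periodic continued fraction. -/
lemma abs_quadratic_le {a : ℕ → ℕ} {α : ℝ} (h : IsCF a α) {n l : ℕ}
    (hper : ∀ i, 1 ≤ i → i ≤ l + 1 → a (i + (n + 1)) = a i) :
    |α * (cfQ a (n + 1) + cfQ a n * α) - (cfP a (n + 1) + cfP a n * α)| ≤
      1 / (cfQ a (n + 1) * (cfQ a (l + 1) : ℝ) ^ 2) := by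
  obtain ⟨ha, hlim⟩ := h
  have hq : 0 < cfQ a n := cfQ_pos ha n
  have hq' : 0 < cfQ a (n + 1) := cfQ_pos ha (n + 1)
  have hl := cfQ_pos ha (l + 1)
  have e1 : Tendsto (fun j => cfConv a (j + (l + 1))) atTop (𝓝 α) :=
    (tendsto_add_atTop_iff_nat (l + 1)).2 hlim
  have e2 : Tendsto (fun j => cfConv a (j + (l + 1 + (n + 1)))) atTop (𝓝 α) :=
    (tendsto_add_atTop_iff_nat (l + 1 + (n + 1))).2 hlim
  have hlim' := ((e2.mul ((e1.const_mul (cfQ a n : ℝ)).const_add (cfQ a (n + 1) : ℝ))).sub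
    ((e1.const_mul (cfP a n : ℝ)).const_add (cfP a (n + 1) : ℝ))).abs
  refine le_of_tendsto hlim' (Eventually.of_forall fun j => ?_)
  show |cfConv a (j + (l + 1 + (n + 1))) * (cfQ a (n + 1) + cfQ a n * cfConv a (j + (l + 1)))
    - (cfP a (n + 1) + cfP a n * cfConv a (j + (l + 1)))| ≤ _
  rw [show j + (l + 1 + (n + 1)) = n + 1 + (l + 1 + j) by omega, cfConv_add ha, add_comm j]
  have hd := abs_cfConv_sub_le (one_le_shift ha (n + 1)) ha hper j
  rw [(cf_congr hper (l + 1) le_rfl).1] at hd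
  set t := cfConv (fun i => a (i + (n + 1))) (l + 1 + j)
  set s := cfConv a (l + 1 + j)
  have ht0 : 0 ≤ t := cfConv_nonneg _ _
  have hpos : (0 : ℝ) < cfQ a (n + 1) + cfQ a n * t := by positivity
  have : ((cfP a (n + 1) + cfP a n * t) / (cfQ a (n + 1) + cfQ a n * t) : ℝ)
      * (cfQ a (n + 1) + cfQ a n * s) - (cfP a (n + 1) + cfP a n * s)
      = (-1) ^ n * (s - t) / (cfQ a (n + 1) + cfQ a n * t) := by
    rw [← cf_det a n]
    field_simp
    ring
  rw [this, abs_div, abs_mul, abs_pow, abs_neg, abs_one, one_pow, one_mul,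
    abs_of_pos hpos, abs_sub_comm, mul_comm (cfQ a (n + 1) : ℝ), ← div_div]
  refine div_le_div₀ (by positivity) hd (by positivity) ?_
  have : (0 : ℝ) ≤ cfQ a n * t := by positivity
  linarith

/-- Dirichlet's theorem with a congruence condition. -/
lemma exists_dirichlet_dvd (β : ℝ) (u w : ℤ) (V R : ℕ) (hV : 0 < V) (hR : 0 < R) :
    ∃ (q : ℕ) (r : ℤ), 0 < q ∧ q ≤ R * V ∧ |q * β - r| ≤ 1 / R ∧ (V : ℤ) ∣ u * q + w * r := by
  have : NeZero V := ⟨hV.ne'⟩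
  have hR' : (0 : ℝ) < R := by exact_mod_cast hR
  let f : ℕ → ℕ × ZMod V := fun q =>
    (⌊(R : ℝ) * Int.fract (q * β)⌋₊, ((u * q + w * ⌊q * β⌋ : ℤ) : ZMod V))
  have hmaps : ∀ q ∈ Finset.range (R * V + 1),
      f q ∈ Finset.range R ×ˢ (Finset.univ : Finset (ZMod V)) := by
    intro q _
    simp only [f, Finset.mem_product, Finset.mem_univ, and_true, Finset.mem_range]
    rw [Nat.floor_lt (mul_nonneg hR'.le (Int.fract_nonneg _))]
    nlinarith [Int.fract_lt_one (q * β)]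
  have key : ∃ i j : ℕ, i < j ∧ j ≤ R * V ∧ f i = f j := by
    obtain ⟨i, hi, j, hj, hij, hf⟩ := Finset.exists_ne_map_eq_of_card_lt_of_maps_to
      (by simp [ZMod.card]) hmaps
    simp only [Finset.mem_range] at hi hj
    rcases lt_or_gt_of_ne hij with h | h
    · exact ⟨i, j, h, by omega, hf⟩
    · exact ⟨j, i, h, by omega, hf.symm⟩
  obtain ⟨i, j, hij, hj, hf⟩ := key
  simp only [f, Prod.mk.injEq] at hf
  obtain ⟨hf1, hf2⟩ := hf
  refine ⟨j - i, ⌊j * β⌋ - ⌊i * β⌋, by omega, by omega, ?_, ?_⟩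
  · rw [Nat.cast_sub hij.le]
    push_cast
    have e : ((j : ℝ) - i) * β - (⌊j * β⌋ - ⌊i * β⌋) = Int.fract (j * β) - Int.fract (i * β) := by
      simp only [Int.fract]; ring
    rw [e, le_div_iff₀ hR', ← Nat.abs_cast R, ← abs_mul]
    have p1 := Nat.floor_le (mul_nonneg hR'.le (Int.fract_nonneg (i * β)))
    have p2 := Nat.floor_le (mul_nonneg hR'.le (Int.fract_nonneg (j * β)))
    have p3 := Nat.lt_floor_add_one ((R : ℝ) * Int.fract (i * β))
    have p4 := Nat.lt_floor_add_one ((R : ℝ) * Int.fract (j * β))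
    rw [hf1] at p1 p3
    exact abs_le.2 ⟨by linarith, by linarith⟩
  · rw [ZMod.intCast_eq_intCast_iff_dvd_sub] at hf2
    rw [Nat.cast_sub hij.le]
    convert hf2 using 1
    ring

/-- A nearly vanishing integer linear form in `1, α, β` produces a small value of
`q * ‖qα‖ * ‖qβ‖`. -/
lemma exists_product_le (α β : ℝ) (u v w : ℤ) (hv : v ≠ 0) (R : ℕ) (hR : 0 < R) :
    ∃ q : ℕ+, ((q : ℕ) : ℝ) * nint (((q : ℕ) : ℝ) * α) * nint (((q : ℕ) : ℝ) * β) ≤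
      R * |(v : ℝ)| * |u + v * α + w * β| + |(w : ℝ)| / R := by
  obtain ⟨q, r, hq0, hqR, hr, hdvd⟩ :=
    exists_dirichlet_dvd β u w v.natAbs R (Int.natAbs_pos.2 hv) hR
  refine ⟨⟨q, hq0⟩, ?_⟩
  show (q : ℝ) * nint (q * α) * nint (q * β) ≤ _
  rw [Int.natAbs_dvd] at hdvd
  obtain ⟨p, hp⟩ := hdvd
  have hR' : (0 : ℝ) < R := by exact_mod_cast hR
  have hq' : (0 : ℝ) < q := by exact_mod_cast hq0
  have hv' : (0 : ℝ) < |(v : ℝ)| := abs_pos.2 (by exact_mod_cast hv)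
  have hpR : (u : ℝ) * q + w * r = v * p := by exact_mod_cast hp
  have hqR' : (q : ℝ) ≤ R * |(v : ℝ)| := by
    have : (q : ℝ) ≤ R * (v.natAbs : ℝ) := by exact_mod_cast hqR
    rwa [Nat.cast_natAbs, Int.cast_abs] at this
  have h1 : nint (q * β) ≤ 1 / R := (nint_le_abs_sub_int _ r).trans hr
  set ε := (u : ℝ) + v * α + w * β with hε
  have h2 : |(v : ℝ)| * nint (q * α) ≤ R * |(v : ℝ)| * |ε| + |(w : ℝ)| * (1 / R) := by
    have e : (v : ℝ) * (q * α - ((-p : ℤ) : ℝ)) = q * ε - w * (q * β - r) := by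
      push_cast
      rw [hε]
      linear_combination -hpR
    calc |(v : ℝ)| * nint (q * α) ≤ |(v : ℝ)| * |q * α - ((-p : ℤ) : ℝ)| :=
          mul_le_mul_of_nonneg_left (nint_le_abs_sub_int _ _) hv'.le
      _ = |q * ε - w * (q * β - r)| := by rw [← abs_mul, e]
      _ ≤ |q * ε| + |w * (q * β - r)| := abs_sub _ _
      _ = q * |ε| + |(w : ℝ)| * |q * β - r| := by rw [abs_mul, abs_mul, abs_of_pos hq']
      _ ≤ _ := by gcongr
  calc (q : ℝ) * nint (q * α) * nint (q * β)
      ≤ (R * |(v : ℝ)|) * nint (q * α) * (1 / R) := by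
        have := nint_nonneg (q * α)
        have := nint_nonneg (q * β)
        gcongr
    _ = |(v : ℝ)| * nint (q * α) := by field_simp
    _ ≤ _ := by rw [div_eq_mul_one_div]; exact h2

/-- If `|v|² * |u + vα + wβ|` can be made arbitrarily small with `|w| / |v|` bounded,
then the Littlewood infimum vanishes. -/
lemma littlewood_of_linear_forms (α β W : ℝ)
    (h : ∀ η > 0, ∃ u v w : ℤ, v ≠ 0 ∧ |(w : ℝ)| ≤ W * |(v : ℝ)| ∧
      |(v : ℝ)| ^ 2 * |u + v * α + w * β| ≤ η) :
    (⨅ q : ℕ+, ((q : ℕ) : ℝ) * nint (((q : ℕ) : ℝ) * α) *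
        nint (((q : ℕ) : ℝ) * β)) = 0 := by
  have hnn : ∀ q : ℕ+, 0 ≤ ((q : ℕ) : ℝ) * nint (((q : ℕ) : ℝ) * α) *
      nint (((q : ℕ) : ℝ) * β) := fun q =>
    mul_nonneg (mul_nonneg (by positivity) (nint_nonneg _)) (nint_nonneg _)
  refine le_antisymm (le_of_forall_pos_le_add fun η hη => ?_) (le_ciInf hnn)
  rw [zero_add]
  obtain ⟨t, ht⟩ := exists_nat_gt (max 0 (2 * W / η))
  have ht0 : (0 : ℝ) < t := (le_max_left _ _).trans_lt ht
  have htW : W / t ≤ η / 2 := by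
    have := (le_max_right _ _).trans_lt ht
    rw [div_lt_iff₀ hη] at this
    rw [div_le_iff₀ ht0]
    linarith
  obtain ⟨u, v, w, hv, hw, he⟩ := h (η / 2 / t) (by positivity)
  have hv' : (0 : ℝ) < |(v : ℝ)| := abs_pos.2 (by exact_mod_cast hv)
  obtain ⟨q, hq⟩ := exists_product_le α β u v w hv (t * v.natAbs)
    (Nat.mul_pos (by exact_mod_cast ht0) (Int.natAbs_pos.2 hv))
  refine (ciInf_le ⟨0, by rintro _ ⟨q, rfl⟩; exact hnn q⟩ q).trans (hq.trans ?_)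
  push_cast
  rw [Nat.cast_natAbs, Int.cast_abs]
  have e1 : (t : ℝ) * |(v : ℝ)| * |(v : ℝ)| * |u + v * α + w * β| ≤ η / 2 := by
    rw [le_div_iff₀ ht0] at he
    linarith
  have e2 : |(w : ℝ)| / (t * |(v : ℝ)|) ≤ η / 2 := by
    refine le_trans ?_ htW
    rw [div_le_div_iff₀ (by positivity) ht0]
    nlinarith
  linarith

/-- The Littlewood infimum vanishes when arbitrarily good repetitions occur in the continued
fraction expansion. -/
lemma littlewood_of_periods {a : ℕ → ℕ} {α : ℝ} (hcf : IsCF a α) (hbad : IsBad α)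
    (h : ∀ η > 0, ∃ n l : ℕ, (∀ i, 1 ≤ i → i ≤ l + 1 → a (i + (n + 1)) = a i) ∧
      (cfQ a (n + 1) : ℝ) / (cfQ a (l + 1) : ℝ) ^ 2 ≤ η)
    (β : ℝ) (A B C D : ℤ) (hdet : A * D - B * C ≠ 0)
    (hβ : β = ((A : ℝ) * α + B) / ((C : ℝ) * α + D)) :
    (⨅ q : ℕ+, ((q : ℕ) : ℝ) * nint (((q : ℕ) : ℝ) * α) *
        nint (((q : ℕ) : ℝ) * β)) = 0 := by
  by_cases hCD : (C : ℝ) * α + D = 0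
  · rw [hCD, div_zero] at hβ
    simp [hβ, nint]
  rw [eq_div_iff hCD] at hβ
  obtain ⟨K, hK⟩ := hbad.exists_bound hcf
  set Δ : ℝ := (A : ℝ) * D - B * C with hΔ
  have hΔ1 : 1 ≤ |Δ| := by
    rw [hΔ]
    exact_mod_cast Int.one_le_abs hdet
  have hΔ0 : 0 < |Δ| := by linarith
  set S : ℝ := (D : ℝ) ^ 2 + |(C : ℝ) * D| + (C : ℝ) ^ 2
  have hS0 : 0 ≤ S := by positivity
  set E : ℝ := |Δ| ^ 2 * (|C * Δ| / |C * α + D|)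
  have hE0 : 0 ≤ E := by positivity
  refine littlewood_of_linear_forms α β (S * (K + 1)) fun η hη => ?_
  obtain ⟨n, l, hper, hle⟩ := h (η / (E + 1)) (by positivity)
  have hq : 0 < cfQ a n := cfQ_pos hcf.1 n
  have hq' : 0 < cfQ a (n + 1) := cfQ_pos hcf.1 (n + 1)
  have hl := cfQ_pos hcf.1 (l + 1)
  have hqq : cfQ a n ≤ cfQ a (n + 1) := cfQ_mono hcf.1 (Nat.le_succ n)
  have hpq : cfP a (n + 1) ≤ cfQ a (n + 1) := cfP_le_cfQ hcf.1 _
  have hpq' : cfP a n ≤ cfQ a (n + 1) := (cfP_le_cfQ hcf.1 n).trans hqq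
  have hqK : cfQ a (n + 1) ≤ (K + 1) * cfQ a n := cfQ_succ_le hcf.1 hK n
  have hquad := abs_quadratic_le hcf hper
  refine ⟨A * C * (-(cfP a (n + 1) : ℤ)) - B * C * (cfQ a (n + 1) - cfP a n) + B * D * cfQ a n,
    (A * D - B * C) * cfQ a n,
    -(D ^ 2 * cfQ a n - C * D * (cfQ a (n + 1) - cfP a n) + C ^ 2 * (-(cfP a (n + 1) : ℤ))),
    mul_ne_zero hdet (by exact_mod_cast hq.ne'), ?_, ?_⟩
  · push_cast
    rw [← hΔ, abs_neg, abs_mul, abs_of_nonneg (a := (cfQ a n : ℝ)) (by positivity)]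
    have r1 : (cfQ a n : ℝ) ≤ cfQ a (n + 1) := by exact_mod_cast hqq
    have r2 : (cfP a (n + 1) : ℝ) ≤ cfQ a (n + 1) := by exact_mod_cast hpq
    have r3 : (cfP a n : ℝ) ≤ cfQ a (n + 1) := by exact_mod_cast hpq'
    have r4 : (cfQ a (n + 1) : ℝ) ≤ (K + 1) * cfQ a n := by exact_mod_cast hqK
    have r5 : (0 : ℝ) ≤ cfP a n := by positivity
    have r6 : (0 : ℝ) ≤ cfP a (n + 1) := by positivity
    have r7 : (0 : ℝ) ≤ cfQ a n := by positivity
    set Q : ℝ := (cfQ a (n + 1) : ℝ)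
    calc |(D : ℝ) ^ 2 * cfQ a n - C * D * (Q - cfP a n) + C ^ 2 * -(cfP a (n + 1) : ℝ)|
        ≤ |(D : ℝ) ^ 2 * cfQ a n - C * D * (Q - cfP a n)| + |C ^ 2 * -(cfP a (n + 1) : ℝ)| :=
          abs_add_le _ _
      _ ≤ |(D : ℝ) ^ 2 * cfQ a n| + |C * D * (Q - cfP a n)| + |C ^ 2 * -(cfP a (n + 1) : ℝ)| := by
          gcongr; exact abs_sub _ _
      _ = (D : ℝ) ^ 2 * cfQ a n + |(C : ℝ) * D| * (Q - cfP a n) + C ^ 2 * cfP a (n + 1) := by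
          rw [abs_mul _ (Q - _), abs_of_nonneg (a := Q - _) (by linarith), mul_neg, abs_neg,
            abs_of_nonneg (a := (D : ℝ) ^ 2 * _) (by positivity),
            abs_of_nonneg (a := (C : ℝ) ^ 2 * _) (by positivity)]
      _ ≤ (D : ℝ) ^ 2 * Q + |(C : ℝ) * D| * Q + C ^ 2 * Q := by gcongr; linarith
      _ = S * Q := by ring
      _ ≤ S * ((K + 1) * cfQ a n) := by gcongr
      _ ≤ S * (K + 1) * (|Δ| * cfQ a n) := by
          rw [← mul_assoc]
          gcongr
          exact le_mul_of_one_le_left r7 hΔ1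
  · push_cast
    rw [← hΔ]
    set P : ℝ := α * (cfQ a (n + 1) + cfQ a n * α) - (cfP a (n + 1) + cfP a n * α) with hP
    have e : ((A : ℝ) * C * -(cfP a (n + 1) : ℝ) - B * C * (cfQ a (n + 1) - cfP a n)
        + B * D * cfQ a n + Δ * cfQ a n * α
        + -(D ^ 2 * cfQ a n - C * D * (cfQ a (n + 1) - cfP a n) + C ^ 2 * -(cfP a (n + 1) : ℝ)) * β)
        = C * Δ * P / (C * α + D) := by
      rw [eq_div_iff hCD, hP, hΔ]
      linear_combination -(D ^ 2 * cfQ a n - C * D * (cfQ a (n + 1) - cfP a n)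
        + C ^ 2 * -(cfP a (n + 1) : ℝ)) * hβ
    rw [e, abs_div, abs_mul _ P, abs_mul Δ, abs_of_nonneg (a := (cfQ a n : ℝ)) (by positivity)]
    have hq0' : (0 : ℝ) < cfQ a (n + 1) := by exact_mod_cast hq'
    have hl0 : (0 : ℝ) < cfQ a (l + 1) := by exact_mod_cast hl
    have hc0 : 0 < |C * α + D| := abs_pos.2 hCD
    calc (|Δ| * cfQ a n) ^ 2 * (|C * Δ| * |P| / |C * α + D|)
        = E * ((cfQ a n : ℝ) ^ 2 * |P|) := by simp only [E]; ring
      _ ≤ E * ((cfQ a (n + 1) : ℝ) ^ 2 * (1 / (cfQ a (n + 1) * (cfQ a (l + 1) : ℝ) ^ 2))) := by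
          gcongr
      _ = E * (cfQ a (n + 1) / (cfQ a (l + 1) : ℝ) ^ 2) := by field_simp
      _ ≤ E * (η / (E + 1)) := by gcongr
      _ ≤ η := by
          rw [← mul_div_assoc, div_le_iff₀ (by positivity)]
          nlinarith

lemma tendsto_cfQ_atTop {a : ℕ → ℕ} (ha : ∀ i, 1 ≤ i → 1 ≤ a i) :
    Tendsto (fun n => (cfQ a n : ℝ)) atTop atTop := by
  refine tendsto_natCast_atTop_atTop.comp
    (tendsto_atTop_atTop_of_monotone (cfQ_mono ha) fun b => ⟨2 * b ^ 2, ?_⟩)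
  by_contra! hlt
  have h1 := two_pow_le_cfQ_sq ha (2 * b ^ 2)
  have h2 : 2 * b ^ 2 < 2 ^ (2 * b ^ 2) := Nat.lt_two_pow_self
  have h3 := Nat.pow_le_pow_left hlt.le 2
  omega

/-- Exponential growth bounds for `cfQ` read off from the limits of `q_l ^ (1 / l)`. -/
lemma eventually_cfQ_exp_bounds {a : ℕ → ℕ} (ha : ∀ i, 1 ≤ i → 1 ≤ a i) {K : ℕ}
    (hK : ∀ i, 1 ≤ i → a i ≤ K) {x : ℝ} (hx : 0 < x)
    (hcond : (1 / 2) * Real.log (limsup (fun l : ℕ => (cfQ a l : ℝ) ^ (1 / (l : ℝ))) atTop) /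
      Real.log (liminf (fun l : ℕ => (cfQ a l : ℝ) ^ (1 / (l : ℝ))) atTop) < x) :
    ∃ σ ρ : ℝ, 0 < ρ ∧ σ < 2 * x * ρ ∧
      ∀ᶠ l : ℕ in atTop, (cfQ a l : ℝ) ≤ Real.exp (σ * l) ∧ Real.exp (ρ * l) ≤ cfQ a l := by
  set f : ℕ → ℝ := fun l => (cfQ a l : ℝ) ^ (1 / (l : ℝ)) with hf
  have hup : ∀ l, f l ≤ K + 1 := by
    intro l
    rcases Nat.eq_zero_or_pos l with rfl | hl
    · simp [f]
    have hl' : (0 : ℝ) < l := by exact_mod_cast hl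
    have : (cfQ a l : ℝ) ≤ ((K : ℝ) + 1) ^ l := by exact_mod_cast cfQ_le_pow ha hK l
    calc f l ≤ (((K : ℝ) + 1) ^ l) ^ (1 / (l : ℝ)) :=
          Real.rpow_le_rpow (by positivity) this (by positivity)
      _ = K + 1 := by
          rw [← Real.rpow_natCast, ← Real.rpow_mul (by positivity), mul_one_div_cancel hl'.ne',
            Real.rpow_one]
  have hlow : ∀ l ≥ 2, (2 : ℝ) ^ (1 / 4 : ℝ) ≤ f l := by
    intro l hl
    have hl' : (2 : ℝ) ≤ l := by exact_mod_cast hl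
    have hq : (0 : ℝ) < cfQ a l := by exact_mod_cast cfQ_pos ha l
    have h1 : (2 : ℝ) ^ l ≤ 2 * (cfQ a l : ℝ) ^ 2 := by exact_mod_cast two_pow_le_cfQ_sq ha l
    have h2 := Real.log_le_log (by positivity) h1
    rw [Real.log_pow, Real.log_mul (by norm_num) (by positivity), Real.log_pow] at h2
    push_cast at h2
    rw [hf, ← Real.log_le_log_iff (by positivity) (by positivity), Real.log_rpow (by norm_num),
      Real.log_rpow hq, one_div_mul_eq_div, one_div_mul_eq_div, div_le_div_iff₀ (by norm_num)
        (by linarith)]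
    nlinarith [Real.log_pos one_lt_two]
  have hbA : IsBoundedUnder (· ≤ ·) atTop f := isBoundedUnder_of ⟨_, hup⟩
  have hbB : IsBoundedUnder (· ≥ ·) atTop f :=
    ⟨_, eventually_map.2 (eventually_atTop.2 ⟨2, hlow⟩)⟩
  have hm1 : (2 : ℝ) ^ (1 / 4 : ℝ) ≤ liminf f atTop :=
    le_liminf_of_le hbA.isCoboundedUnder_ge (eventually_atTop.2 ⟨2, hlow⟩)
  have hmM : liminf f atTop ≤ limsup f atTop := liminf_le_limsup hbA hbB
  have h2 : (1 : ℝ) < 2 ^ (1 / 4 : ℝ) := Real.one_lt_rpow (by norm_num) (by norm_num)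
  set m := liminf f atTop
  set M := limsup f atTop
  have hlogm : 0 < Real.log m := Real.log_pos (h2.trans_le hm1)
  have hlogM : 0 < Real.log M := Real.log_pos (h2.trans_le (hm1.trans hmM))
  rw [div_lt_iff₀ hlogm] at hcond
  obtain ⟨ρ, hρ1, hρ2⟩ := exists_between
    (show Real.log M / (2 * x) < Real.log m by rw [div_lt_iff₀ (by positivity)]; linarith)
  have hρ0 : 0 < ρ := lt_trans (by positivity) hρ1
  obtain ⟨σ, hσ1, hσ2⟩ := exists_between
    (show Real.log M < 2 * x * ρ by rw [div_lt_iff₀ (by positivity)] at hρ1; linarith)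
  refine ⟨σ, ρ, hρ0, hσ2, ?_⟩
  have g1 : ∀ᶠ l in atTop, f l < Real.exp σ := by
    refine eventually_lt_of_limsup_lt ?_ hbA
    rwa [← Real.log_lt_iff_lt_exp (by linarith)]
  have g2 : ∀ᶠ l in atTop, Real.exp ρ < f l := by
    refine eventually_lt_of_lt_liminf ?_ hbB
    rwa [← Real.lt_log_iff_exp_lt (by linarith)]
  filter_upwards [g1, g2, eventually_ge_atTop 1] with l h1 h2 hl
  have hl' : (0 : ℝ) < l := by exact_mod_cast hl
  have e : (cfQ a l : ℝ) = f l ^ (l : ℝ) := by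
    rw [hf, ← Real.rpow_mul (by positivity), one_div_mul_cancel hl'.ne', Real.rpow_one]
  rw [e, Real.exp_mul, Real.exp_mul]
  exact ⟨Real.rpow_le_rpow (by simp only [f]; positivity) h1.le hl'.le,
    Real.rpow_le_rpow (by positivity) h2.le hl'.le⟩

/-- For `x < 1` the block `W ^ x` is a prefix of `W`, and for `x ≥ 1` it begins with `W`. -/
lemma wordPow_prefix (W : List ℕ) {x : ℚ} (hx : 0 < x) :
    W.take (if 1 ≤ x then W.length else ⌈x * W.length⌉₊) <+: wordPow W x := by
  unfold wordPow
  split_ifs with h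
  · have : 1 ≤ ⌊x⌋ := Int.le_floor.2 (by exact_mod_cast h)
    obtain ⟨t, ht⟩ : ∃ t, (⌊x⌋).toNat = t + 1 := ⟨(⌊x⌋).toNat - 1, by omega⟩
    rw [ht, List.replicate_succ, List.flatten_cons, List.take_length, List.append_assoc]
    exact List.prefix_append _ _
  · have : ⌊x⌋ = 0 := Int.floor_eq_zero_iff.2 ⟨hx.le, not_le.1 h⟩
    rw [this, Int.cast_zero, sub_zero, Int.toNat_zero, List.replicate_zero, List.flatten_nil,
      List.nil_append, Int.ceil_toNat]

/-- If an expansion begins with `W W ^ x`, then its initial segment recurs after `|W|` terms. -/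
lemma periodic_of_prefix {a : ℕ → ℕ} {W : List ℕ} {x : ℚ} (hx : 0 < x)
    (hpre : ∀ i < (W ++ wordPow W x).length, a (i + 1) = (W ++ wordPow W x).getD i 0) (i : ℕ)
    (hi : 1 ≤ i) (hiL : i ≤ if 1 ≤ x then W.length else ⌈x * W.length⌉₊) :
    a (i + W.length) = a i := by
  obtain ⟨j, rfl⟩ : ∃ j, i = j + 1 := ⟨i - 1, by omega⟩
  have hLn : (if 1 ≤ x then W.length else ⌈x * W.length⌉₊) ≤ W.length := by
    split_ifs with h
    · exact le_rfl
    · refine Nat.ceil_le.2 (mul_le_of_le_one_left (by positivity) (not_le.1 h).le)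
  obtain ⟨t, ht⟩ := wordPow_prefix W hx
  set L := if 1 ≤ x then W.length else ⌈x * W.length⌉₊
  have hlen : L ≤ (wordPow W x).length := by
    rw [← ht, List.length_append, List.length_take, min_eq_left hLn]
    omega
  have hj : j < W.length := by omega
  rw [show j + 1 + W.length = (W.length + j) + 1 by omega,
    hpre _ (by rw [List.length_append]; omega), hpre j (by rw [List.length_append]; omega)]
  rw [List.getD_append_right _ _ _ _ (by omega), List.getD_append _ _ _ _ hj, ← ht,
    Nat.add_sub_cancel_left,
    List.getD_append _ _ _ _ (by rw [List.length_take, min_eq_left hLn]; omega)]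
  simp [List.getD_eq_getElem?_getD, show j < L by omega]

/-- Theorem 4 of Adamczewski–Bugeaud.  Let `α` be badly
approximable with continued fraction expansion `a` and convergent denominators
`cfQ a`.  Suppose there are a positive rational `x` and finite words `U k`,
with `|U (k+1)| > |U k|`, such that for each `k` the expansion of `α` begins
with the block `U k` followed by `(U k)^x`.  Put
`M = limsup (q_ℓ)^{1/ℓ}` and `m = liminf (q_ℓ)^{1/ℓ}`.  If `x ≥ 1` or
`x > (1/2)·log M / log m`, then for every `β` equal to `α` up to a rational
homography, `inf_{q ≥ 1} q·‖qα‖·‖qβ‖ = 0`. -/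
theorem littlewood_of_repetitions
    (α : ℝ) (a : ℕ → ℕ) (hcf : IsCF a α) (hbad : IsBad α)
    (x : ℚ) (hx : 0 < x) (U : ℕ → List ℕ)
    (hpre : ∀ k : ℕ, 1 ≤ k → ∀ i < (U k ++ wordPow (U k) x).length,
      a (i + 1) = (U k ++ wordPow (U k) x).getD i 0)
    (hlen : ∀ k : ℕ, 1 ≤ k → (U k).length < (U (k + 1)).length)
    (M m : ℝ)
    (hM : M = limsup (fun l : ℕ => (cfQ a l : ℝ) ^ (1 / (l : ℝ))) atTop)
    (hm : m = liminf (fun l : ℕ => (cfQ a l : ℝ) ^ (1 / (l : ℝ))) atTop)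
    (hcond : 1 ≤ x ∨ (1 / 2) * Real.log M / Real.log m < (x : ℝ))
    (β : ℝ) (A B C D : ℤ) (hdet : A * D - B * C ≠ 0)
    (hβ : β = ((A : ℝ) * α + B) / ((C : ℝ) * α + D)) :
    (⨅ q : ℕ+, ((q : ℕ) : ℝ) * nint (((q : ℕ) : ℝ) * α) *
        nint (((q : ℕ) : ℝ) * β)) = 0 := by
  subst hM hm
  obtain ⟨K, hK⟩ := hbad.exists_bound hcf
  have ha := hcf.1
  refine littlewood_of_periods hcf hbad (fun η hη => ?_) β A B C D hdet hβ
  have hlenTop : ∀ k, k ≤ (U (k + 1)).length := by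
    intro k
    induction k with
    | zero => omega
    | succ k ih => have := hlen (k + 1) (by omega); omega
  have hU : Tendsto (fun k => (U (k + 1)).length) atTop atTop :=
    tendsto_atTop_mono hlenTop tendsto_id
  set L : ℕ → ℕ := fun n => if 1 ≤ x then n else ⌈x * n⌉₊ with hL
  have hLpos : ∀ n, 1 ≤ n → 1 ≤ L n := by
    intro n hn
    simp only [L]
    split_ifs
    · exact hn
    · exact Nat.ceil_pos.2 (by positivity)
  have key : ∀ᶠ n : ℕ in atTop, (cfQ a n : ℝ) / (cfQ a (L n) : ℝ) ^ 2 ≤ η := by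
    by_cases h1 : 1 ≤ x
    · filter_upwards [(tendsto_cfQ_atTop ha).eventually_ge_atTop (1 / η)] with n hn
      have hq : (0 : ℝ) < cfQ a n := by exact_mod_cast cfQ_pos ha n
      simp only [L, if_pos h1]
      rw [div_le_iff₀ hη] at hn
      rw [div_le_iff₀ (by positivity)]
      nlinarith
    · obtain ⟨σ, ρ, hρ, hσ, hev⟩ := eventually_cfQ_exp_bounds ha hK
        (show (0 : ℝ) < x by exact_mod_cast hx) (hcond.resolve_left h1)
      have hLx : ∀ n : ℕ, (x : ℝ) * n ≤ L n := by
        intro n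
        simp only [L, if_neg h1]
        exact_mod_cast Nat.le_ceil (x * n)
      have hLtop : Tendsto L atTop atTop := by
        rw [← tendsto_natCast_atTop_iff (R := ℝ)]
        exact tendsto_atTop_mono hLx
          (tendsto_natCast_atTop_atTop.const_mul_atTop (by exact_mod_cast hx))
      have hexp : Tendsto (fun n : ℕ => Real.exp ((σ - 2 * x * ρ) * n)) atTop (𝓝 0) :=
        Real.tendsto_exp_atBot.comp
          (tendsto_natCast_atTop_atTop.const_mul_atTop_of_neg (by linarith))
      filter_upwards [hev, hLtop.eventually hev, hexp.eventually_le_const hη] with n h2 h3 h4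
      refine le_trans ?_ h4
      calc (cfQ a n : ℝ) / (cfQ a (L n) : ℝ) ^ 2
          ≤ Real.exp (σ * n) / Real.exp (ρ * L n) ^ 2 := by
            gcongr
            · exact h2.1
            · exact h3.2
        _ = Real.exp (σ * n - 2 * (ρ * L n)) := by
            rw [← Real.exp_nat_mul, ← Real.exp_sub]; norm_num
        _ ≤ _ := by
            refine Real.exp_le_exp.2 ?_
            nlinarith [mul_le_mul_of_nonneg_left (hLx n) hρ.le]
  obtain ⟨k, hk1, hk2⟩ := ((hU.eventually key).and (hU.eventually_ge_atTop 1)).exists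
  obtain ⟨n, hn⟩ : ∃ n, (U (k + 1)).length = n + 1 := ⟨(U (k + 1)).length - 1, by omega⟩
  obtain ⟨l, hl⟩ : ∃ l, L (n + 1) = l + 1 := ⟨L (n + 1) - 1, by have := hLpos (n + 1); omega⟩
  rw [hn, hl] at hk1
  refine ⟨n, l, fun i hi hil => ?_, hk1⟩
  rw [← hn]
  refine periodic_of_prefix hx (hpre (k + 1) (by omega)) i hi ?_
  rw [hn]
  exact hil.trans hl.ge
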